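/- Let p be a prime, g ≥ 1, and let γ′, γ″ ∈ GSp_{2g}(ℤ_p) each have separable characteristic polynomial over ℚ_p (regular semisimple), with the same characteristic polynomial, and assume γ′ and γ″ are not conjugate by any element of GSp_{2g}(ℚ_p). Then there exists N such that for all n ≥ N there is no pair δ′, δ″ ∈ GSp_{2g}(ℤ_p) with δ′ conjugate to γ′ in GSp_{2g}(ℚ_p), δ″ conjugate to γ″ in GSp_{2g}(ℚ_p), and δ′ ≡ δ″ entrywise modulo pⁿ. -/

import Mathlib

open Matrix

/-- The standard symplectic matrix `J = [[0, -1], [1, 0]]` in `g × g` block form. -/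
def Jmat (R : Type*) [CommRing R] (g : ℕ) :
    Matrix (Fin g ⊕ Fin g) (Fin g ⊕ Fin g) R :=
  Matrix.fromBlocks 0 (-1) 1 0

variable (p : ℕ) [Fact p.Prime] (g : ℕ)

/-- `GSp_{2g}(ℤ_p)`: integral symplectic similitudes with unit multiplier. -/
def GSpZp : Set (Matrix (Fin g ⊕ Fin g) (Fin g ⊕ Fin g) ℤ_[p]) :=
  {A | ∃ η : ℤ_[p]ˣ, Aᵀ * Jmat ℤ_[p] g * A = (η : ℤ_[p]) • Jmat ℤ_[p] g}

/-- `GSp_{2g}(ℚ_p)`: invertible symplectic similitudes with nonzero multiplier. -/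
def GSpQp : Set (Matrix (Fin g ⊕ Fin g) (Fin g ⊕ Fin g) ℚ_[p]) :=
  {A | IsUnit A.det ∧ ∃ η : ℚ_[p], η ≠ 0 ∧ Aᵀ * Jmat ℚ_[p] g * A = η • Jmat ℚ_[p] g}

/-- Entrywise inclusion of integral matrices into `p`-adic matrices. -/
def matQp (A : Matrix (Fin g ⊕ Fin g) (Fin g ⊕ Fin g) ℤ_[p]) :
    Matrix (Fin g ⊕ Fin g) (Fin g ⊕ Fin g) ℚ_[p] :=
  A.map ((↑) : ℤ_[p] → ℚ_[p])

/-- `γ₀` and `γ` are conjugate by an element of `GSp_{2g}(ℚ_p)`. -/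
def ConjQp (γ₀ γ : Matrix (Fin g ⊕ Fin g) (Fin g ⊕ Fin g) ℤ_[p]) : Prop :=
  ∃ h ∈ GSpQp p g, h⁻¹ * matQp p g γ₀ * h = matQp p g γ

/-- Entrywise reduction modulo `pⁿ`. -/
noncomputable def πmod (n : ℕ) (A : Matrix (Fin g ⊕ Fin g) (Fin g ⊕ Fin g) ℤ_[p]) :
    Matrix (Fin g ⊕ Fin g) (Fin g ⊕ Fin g) (ZMod (p ^ n)) :=
  A.map (PadicInt.toZModPow n)

/-- `GSp_{2g}(ℤ/pⁿℤ)`: mod `pⁿ` symplectic similitudes with unit multiplier. -/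
def GSpMod (n : ℕ) : Set (Matrix (Fin g ⊕ Fin g) (Fin g ⊕ Fin g) (ZMod (p ^ n))) :=
  {A | ∃ η : (ZMod (p ^ n))ˣ, Aᵀ * Jmat (ZMod (p ^ n)) g * A = (η : ZMod (p ^ n)) • Jmat (ZMod (p ^ n)) g}

/-- `M(ℤ/pⁿℤ)_d`: similitudes mod `pⁿ` whose determinant is a unit times `pᵏ`, `k ≤ min d (n-1)`. -/
def Mmodd (n d : ℕ) : Set (Matrix (Fin g ⊕ Fin g) (Fin g ⊕ Fin g) (ZMod (p ^ n))) :=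
  {A | (∃ η : ZMod (p ^ n), Aᵀ * Jmat (ZMod (p ^ n)) g * A = η • Jmat (ZMod (p ^ n)) g) ∧
    ∃ u : (ZMod (p ^ n))ˣ, ∃ k : ℕ, k ≤ min d (n - 1) ∧
      A.det = (u : ZMod (p ^ n)) * (p : ZMod (p ^ n)) ^ k}

/-- The set `C_{(d,n)}(γ₀)` of elements of `GSp_{2g}(ℤ/pⁿℤ)` that are
`M(ℤ/pⁿℤ)_d`-conjugate to `γ₀ mod pⁿ`. -/
def Cdn (n d : ℕ) (γ₀ : Matrix (Fin g ⊕ Fin g) (Fin g ⊕ Fin g) ℤ_[p]) :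
    Set (Matrix (Fin g ⊕ Fin g) (Fin g ⊕ Fin g) (ZMod (p ^ n))) :=
  {γ | γ ∈ GSpMod p g n ∧ ∃ A ∈ Mmodd p g n d, A * γ = πmod p g n γ₀ * A}

/-- The characteristic polynomial of `γ₀`, viewed over `ℚ_p`, is separable
(i.e. `γ₀` is regular semisimple). -/
def RegSS (γ₀ : Matrix (Fin g ⊕ Fin g) (Fin g ⊕ Fin g) ℤ_[p]) : Prop :=
  ((matQp p g γ₀).charpoly).Separable

open Filter Topology Polynomial

section SquareRoot

variable {K 𝔸 : Type*} [NontriviallyNormedField K] [NormedRing 𝔸] [NormedAlgebra K 𝔸]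
  [CompleteSpace 𝔸]

/-- Near `1`, squaring has a continuous local inverse. -/
theorem exists_local_sqrt (h2 : (2 : K) ≠ 0) :
    ∃ s : 𝔸 → 𝔸, Tendsto s (𝓝 1) (𝓝 1) ∧ (∀ᶠ c in 𝓝 1, s c * s c = c) ∧
      ∀ᶠ x in 𝓝 1, s (x * x) = x := by
  have hd : HasStrictFDerivAt (fun x : 𝔸 => x * x)
      ((ContinuousLinearEquiv.smulLeft (Units.mk0 (2 : K) h2) : 𝔸 ≃L[K] 𝔸) : 𝔸 →L[K] 𝔸) 1 := by
    have h := (hasStrictFDerivAt_id (𝕜 := K) (1 : 𝔸)).mul' (hasStrictFDerivAt_id (𝕜 := K) (1 : 𝔸))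
    refine h.congr_fderiv ?_
    ext x
    simp [two_smul, Units.smul_def]
  refine ⟨hd.localInverse, ?_, ?_, hd.eventually_left_inverse⟩
  · simpa using hd.localInverse_tendsto
  · simpa using hd.eventually_right_inverse

end SquareRoot

section Intertwiner

/-- A noncommutative divided difference of `f`: an intertwiner of `d` and `a` when `f` kills both. -/
theorem exists_continuous_intertwiner {K 𝔸 : Type*} [Field K] [Ring 𝔸] [Algebra K 𝔸]
    [TopologicalSpace 𝔸] [IsTopologicalRing 𝔸] (d : 𝔸) (f : K[X]) :
    ∃ X : 𝔸 → 𝔸, Continuous X ∧ (∀ a, d * X a - X a * a = aeval d f - aeval a f) ∧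
      X d = aeval d (derivative f) := by
  induction f using Polynomial.induction_on with
  | C r => exact ⟨fun _ => 0, continuous_const, by simp, by simp⟩
  | add f g hf hg =>
    obtain ⟨X, hX, hX1, hX2⟩ := hf
    obtain ⟨Y, hY, hY1, hY2⟩ := hg
    refine ⟨fun a => X a + Y a, hX.add hY, fun a => ?_, by simp [hX2, hY2]⟩
    have e : d * (X a + Y a) - (X a + Y a) * a
        = (d * X a - X a * a) + (d * Y a - Y a * a) := by noncomm_ring
    rw [e, hX1, hY1, map_add, map_add]
    abel
  | monomial k r h =>
    obtain ⟨X, hX, hX1, hX2⟩ := h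
    have hs : (C r * Polynomial.X ^ (k + 1) : K[X])
        = C r * Polynomial.X ^ k * Polynomial.X := by rw [pow_succ, mul_assoc]
    rw [hs]
    generalize (C r * Polynomial.X ^ k : K[X]) = q at *
    refine ⟨fun a => X a * a + aeval d q, by fun_prop, fun a => ?_, ?_⟩
    · have e : d * (X a * a + aeval d q) - (X a * a + aeval d q) * a
          = (d * X a - X a * a) * a + d * aeval d q - aeval d q * a := by noncomm_ring
      have c : d * aeval d q = aeval d q * d := by
        simpa using congrArg (aeval d) (mul_comm Polynomial.X q)
      rw [e, hX1, c, aeval_mul, aeval_mul, aeval_X, aeval_X]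
      noncomm_ring
    · simp [hX2, derivative_mul]

end Intertwiner

section LocalConjugacy

variable {K 𝔸 : Type*} [NontriviallyNormedField K] [NormedRing 𝔸] [NormedAlgebra K 𝔸]
  [CompleteSpace 𝔸]

/-- Similitudes near `d` with the same multiplier, killed by the same separable polynomial as
`d`, are conjugate to `d` by a unitary element. -/
theorem eventually_exists_unitary_conj (h2 : (2 : K) ≠ 0) (σ : 𝔸 → 𝔸) (hσ : Continuous σ)
    (hmul : ∀ a b, σ (a * b) = σ b * σ a) (hinv : ∀ a, σ (σ a) = a) {η : K} (hη : η ≠ 0)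
    {f : K[X]} (hf : f.Separable) {d : 𝔸} (hd : aeval d f = 0)
    (hdη : σ d * d = algebraMap K 𝔸 η) :
    ∀ᶠ a in 𝓝 d, a * σ a = algebraMap K 𝔸 η → aeval a f = 0 →
      ∃ h w : 𝔸, h * w = 1 ∧ σ h * h = 1 ∧ d * h = h * a := by
  have hone : σ 1 = 1 := by
    have := hmul (σ 1) 1
    rw [mul_one, hinv, mul_one] at this
    exact this.symm
  obtain ⟨s, hs, hs1, hs2⟩ := exists_local_sqrt (K := K) (𝔸 := 𝔸) h2
  obtain ⟨X₀, hX₀, hX₁, hX₂⟩ := exists_continuous_intertwiner d f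
  obtain ⟨u, v, huv⟩ := hf
  set X : 𝔸 → 𝔸 := fun a => aeval d v * X₀ a with hX
  have hXc : Continuous X := by fun_prop
  have hXd : X d = 1 := by
    have := congrArg (aeval d) huv
    simpa [hd, hX, hX₂] using this
  have hcom : d * aeval d v = aeval d v * d := by
    simpa using congrArg (aeval d) (mul_comm Polynomial.X v)
  set c : 𝔸 → 𝔸 := fun a => σ (X a) * X a with hc
  have hcd : Tendsto c (𝓝 d) (𝓝 1) := by
    have h : Continuous c := by fun_prop
    simpa [hc, hXd, hone] using h.tendsto d
  have hsc : Tendsto (fun a => s (c a)) (𝓝 d) (𝓝 1) := hs.comp hcd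
  have hσsc : Tendsto (fun a => σ (s (c a))) (𝓝 d) (𝓝 1) := by
    simpa [hone, Function.comp_def] using (hσ.tendsto 1).comp hsc
  have hconj : Tendsto (fun a => η⁻¹ • (σ a * s (c a) * a)) (𝓝 d) (𝓝 1) := by
    have h := (((hσ.tendsto d).mul hsc).mul tendsto_id).const_smul η⁻¹
    simpa [hdη, Algebra.algebraMap_eq_smul_one, smul_smul, hη] using h
  have hunit : ∀ᶠ y : 𝔸 in 𝓝 1, IsUnit y := Units.isOpen.mem_nhds isUnit_one
  filter_upwards [hcd.eventually hs1, hσsc.eventually hs2, hconj.eventually hs2,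
    hsc.eventually hunit, hXc.tendsto d |>.eventually (hXd ▸ hunit)] with a h1 h3 h4 h5 h6 e2 e3
  have hXa : d * X a = X a * a := by
    have := hX₁ a
    rw [hd, e3, sub_zero, sub_eq_zero] at this
    rw [hX]
    simp only
    rw [← mul_assoc, hcom, mul_assoc, this, mul_assoc]
  have hσc : σ (c a) = c a := by simp only [hc, hmul, hinv]
  have hσy : σ (s (c a)) = s (c a) := by
    rw [← h3, ← hmul, h1, hσc]
  have hca : σ a * c a * a = η • c a := by
    have : σ a * c a * a = σ (X a * a) * (X a * a) := by simp only [hc, hmul, mul_assoc]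
    rw [this, ← hXa, hmul]
    have : σ (X a) * σ d * (d * X a) = σ (X a) * (σ d * d) * X a := by simp only [mul_assoc]
    rw [this, hdη, Algebra.algebraMap_eq_smul_one]
    simp [hc]
  have hya : η⁻¹ • (σ a * s (c a) * a) = s (c a) := by
    rw [← h4]
    congr 1
    have : (σ a * s (c a) * a) * (σ a * s (c a) * a)
        = σ a * s (c a) * (a * σ a) * s (c a) * a := by simp only [mul_assoc]
    rw [smul_mul_smul_comm, this, e2, Algebra.algebraMap_eq_smul_one]
    have : σ a * s (c a) * (η • 1) * s (c a) * a = η • (σ a * (s (c a) * s (c a)) * a) := by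
      simp [mul_assoc]
    rw [this, h1, hca, smul_smul, smul_smul]
    rw [show η⁻¹ * η⁻¹ * η * η = 1 by field_simp, one_smul]
  have hcomm : a * s (c a) = s (c a) * a := by
    conv_lhs => rw [← hya]
    rw [mul_smul_comm, ← mul_assoc, ← mul_assoc, e2, Algebra.algebraMap_eq_smul_one]
    simp [smul_smul, hη]
  obtain ⟨y, hy⟩ := h5
  obtain ⟨x, hx⟩ := h6
  rw [← hy] at hσy hcomm h1
  rw [← hx] at hXa
  have hσyi : σ (↑y⁻¹ : 𝔸) = ↑y⁻¹ := by
    rw [← Units.mul_left_inj y, Units.inv_mul]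
    conv_lhs => rw [← congrArg (σ (↑y⁻¹ : 𝔸) * ·) hσy]
    rw [← hmul, Units.mul_inv, hone]
  refine ⟨x * ↑y⁻¹, y * ↑x⁻¹, by simp [mul_assoc], ?_, ?_⟩
  · rw [hmul, hσyi]
    have : (↑y⁻¹ : 𝔸) * σ x * (x * ↑y⁻¹) = ↑y⁻¹ * (σ x * x) * ↑y⁻¹ := by simp only [mul_assoc]
    rw [this, hx]
    change (↑y⁻¹ : 𝔸) * c a * ↑y⁻¹ = 1
    rw [← h1]
    simp
  · have : a * (↑y⁻¹ : 𝔸) = ↑y⁻¹ * a := by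
      rw [← Units.mul_left_inj y, mul_assoc, Units.inv_mul, mul_one, mul_assoc, hcomm,
        Units.inv_mul_cancel_left]
    rw [← mul_assoc, hXa, mul_assoc, mul_assoc, this]

end LocalConjugacy

section Symplectic

variable {g}

theorem Jmat_mul_Jmat {R : Type*} [CommRing R] : Jmat R g * Jmat R g = -1 := by
  simp [Jmat, Matrix.fromBlocks_multiply, ← Matrix.fromBlocks_one, Matrix.fromBlocks_neg]

theorem Jmat_transpose {R : Type*} [CommRing R] : (Jmat R g)ᵀ = -Jmat R g := by
  simp [Jmat, Matrix.fromBlocks_transpose, Matrix.fromBlocks_neg]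

/-- The adjoint of a matrix for the standard symplectic form. -/
def symplecticAdjoint {R : Type*} [CommRing R] (A : Matrix (Fin g ⊕ Fin g) (Fin g ⊕ Fin g) R) :
    Matrix (Fin g ⊕ Fin g) (Fin g ⊕ Fin g) R :=
  -(Jmat R g * Aᵀ * Jmat R g)

variable {R : Type*} [CommRing R]

theorem symplecticAdjoint_mul (A B : Matrix (Fin g ⊕ Fin g) (Fin g ⊕ Fin g) R) :
    symplecticAdjoint (A * B) = symplecticAdjoint B * symplecticAdjoint A := by
  have : Jmat R g * Bᵀ * Jmat R g * (Jmat R g * Aᵀ * Jmat R g)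
      = Jmat R g * Bᵀ * (Jmat R g * Jmat R g) * Aᵀ * Jmat R g := by simp only [mul_assoc]
  simp only [symplecticAdjoint, neg_mul_neg, this, Jmat_mul_Jmat, Matrix.transpose_mul]
  simp [mul_assoc]

theorem symplecticAdjoint_symplecticAdjoint (A : Matrix (Fin g ⊕ Fin g) (Fin g ⊕ Fin g) R) :
    symplecticAdjoint (symplecticAdjoint A) = A := by
  have : Jmat R g * (Jmat R g * (A * Jmat R g)) * Jmat R g
      = (Jmat R g * Jmat R g) * A * (Jmat R g * Jmat R g) := by simp only [mul_assoc]
  simp [symplecticAdjoint, Jmat_transpose, this, Jmat_mul_Jmat]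

theorem symplecticAdjoint_mul_self_iff {A : Matrix (Fin g ⊕ Fin g) (Fin g ⊕ Fin g) R} {η : R} :
    symplecticAdjoint A * A = algebraMap R _ η ↔ Aᵀ * Jmat R g * A = η • Jmat R g := by
  have e : symplecticAdjoint A * A = -(Jmat R g * (Aᵀ * Jmat R g * A)) := by
    simp [symplecticAdjoint, mul_assoc]
  constructor
  · intro h
    have : Aᵀ * Jmat R g * A = Jmat R g * (symplecticAdjoint A * A) := by
      rw [e, mul_neg, ← mul_assoc, Jmat_mul_Jmat, neg_one_mul, neg_neg]
    rw [this, h, Algebra.algebraMap_eq_smul_one, mul_smul_comm, mul_one]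
  · intro h
    rw [e, h, mul_smul_comm, Jmat_mul_Jmat, Algebra.algebraMap_eq_smul_one, smul_neg, neg_neg]

theorem mul_symplecticAdjoint_self {K : Type*} [Field K]
    {A : Matrix (Fin g ⊕ Fin g) (Fin g ⊕ Fin g) K} {η : K} (hη : η ≠ 0)
    (h : symplecticAdjoint A * A = algebraMap K _ η) :
    A * symplecticAdjoint A = algebraMap K _ η := by
  have h1 : (η⁻¹ • symplecticAdjoint A) * A = 1 := by
    rw [smul_mul_assoc, h, Algebra.algebraMap_eq_smul_one, smul_smul, inv_mul_cancel₀ hη, one_smul]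
  have h2 := mul_eq_one_comm.mp h1
  rw [Algebra.algebraMap_eq_smul_one, ← h2, mul_smul_comm, smul_smul, mul_inv_cancel₀ hη, one_smul]

end Symplectic

section Conjugacy

variable {p g}

theorem mul_mem_GSpQp {A B : Matrix (Fin g ⊕ Fin g) (Fin g ⊕ Fin g) ℚ_[p]}
    (hA : A ∈ GSpQp p g) (hB : B ∈ GSpQp p g) : A * B ∈ GSpQp p g := by
  obtain ⟨hA, a, ha, hA'⟩ := hA
  obtain ⟨hB, b, hb, hB'⟩ := hB
  refine ⟨by rw [Matrix.det_mul]; exact hA.mul hB, a * b, mul_ne_zero ha hb, ?_⟩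
  have : (A * B)ᵀ * Jmat ℚ_[p] g * (A * B) = Bᵀ * (Aᵀ * Jmat ℚ_[p] g * A) * B := by
    simp only [Matrix.transpose_mul, mul_assoc]
  rw [this, hA', mul_smul_comm, smul_mul_assoc, hB', smul_smul]

theorem inv_mem_GSpQp {A : Matrix (Fin g ⊕ Fin g) (Fin g ⊕ Fin g) ℚ_[p]}
    (hA : A ∈ GSpQp p g) : A⁻¹ ∈ GSpQp p g := by
  obtain ⟨hA, a, ha, hA'⟩ := hA
  refine ⟨Matrix.isUnit_nonsing_inv_det A hA, a⁻¹, inv_ne_zero ha, ?_⟩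
  have h1 := Matrix.mul_nonsing_inv A hA
  have e : Jmat ℚ_[p] g = a⁻¹ • (Aᵀ * Jmat ℚ_[p] g * A) := by
    rw [hA', smul_smul, inv_mul_cancel₀ ha, one_smul]
  have h2 : (A⁻¹)ᵀ * Aᵀ = 1 := by rw [← Matrix.transpose_mul, h1, Matrix.transpose_one]
  have : (A⁻¹)ᵀ * (Aᵀ * Jmat ℚ_[p] g * A) * A⁻¹ = Jmat ℚ_[p] g := by
    calc _ = ((A⁻¹)ᵀ * Aᵀ) * Jmat ℚ_[p] g * (A * A⁻¹) := by simp only [mul_assoc]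
      _ = _ := by rw [h1, h2, one_mul, mul_one]
  conv_lhs => rw [e]
  rw [mul_smul_comm, smul_mul_assoc, this]

theorem conjQp_iff {A B : Matrix (Fin g ⊕ Fin g) (Fin g ⊕ Fin g) ℤ_[p]} :
    ConjQp p g A B ↔ ∃ h ∈ GSpQp p g, matQp p g A * h = h * matQp p g B := by
  refine exists_congr fun h => and_congr_right fun hh => ?_
  have h1 := Matrix.mul_nonsing_inv h hh.1
  have h2 := Matrix.nonsing_inv_mul h hh.1
  constructor
  · intro e
    rw [← e, ← mul_assoc, ← mul_assoc, h1, one_mul]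
  · intro e
    rw [mul_assoc, e, ← mul_assoc, h2, one_mul]

theorem ConjQp.symm {A B : Matrix (Fin g ⊕ Fin g) (Fin g ⊕ Fin g) ℤ_[p]} (h : ConjQp p g A B) :
    ConjQp p g B A := by
  obtain ⟨x, hx, h⟩ := conjQp_iff.mp h
  refine ⟨x⁻¹, inv_mem_GSpQp hx, ?_⟩
  rw [Matrix.nonsing_inv_nonsing_inv _ hx.1, ← h, mul_assoc, Matrix.mul_nonsing_inv _ hx.1, mul_one]

theorem ConjQp.trans {A B C : Matrix (Fin g ⊕ Fin g) (Fin g ⊕ Fin g) ℤ_[p]}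
    (h : ConjQp p g A B) (h' : ConjQp p g B C) : ConjQp p g A C := by
  obtain ⟨x, hx, h⟩ := conjQp_iff.mp h
  obtain ⟨y, hy, h'⟩ := conjQp_iff.mp h'
  exact conjQp_iff.mpr ⟨x * y, mul_mem_GSpQp hx hy, by
    rw [← mul_assoc, h, mul_assoc, h', mul_assoc]⟩

theorem ConjQp.charpoly_eq {A B : Matrix (Fin g ⊕ Fin g) (Fin g ⊕ Fin g) ℤ_[p]}
    (h : ConjQp p g A B) : (matQp p g B).charpoly = (matQp p g A).charpoly := by
  obtain ⟨x, hx, h⟩ := h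
  rw [← h]
  exact Matrix.charpoly_units_conj' (Matrix.nonsingInvUnit x hx.1) _

/-- Conjugate similitudes have the same multiplier. -/
theorem ConjQp.multiplier {A B : Matrix (Fin g ⊕ Fin g) (Fin g ⊕ Fin g) ℤ_[p]} {η : ℚ_[p]}
    (h : ConjQp p g A B)
    (hA : (matQp p g A)ᵀ * Jmat ℚ_[p] g * matQp p g A = η • Jmat ℚ_[p] g) :
    (matQp p g B)ᵀ * Jmat ℚ_[p] g * matQp p g B = η • Jmat ℚ_[p] g := by
  obtain ⟨x, hx, h⟩ := conjQp_iff.mp h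
  obtain ⟨hxu, μ, hμ, hx⟩ := hx
  have e : Jmat ℚ_[p] g = μ⁻¹ • (xᵀ * Jmat ℚ_[p] g * x) := by
    rw [hx, smul_smul, inv_mul_cancel₀ hμ, one_smul]
  conv_lhs => rw [e]
  have : (matQp p g B)ᵀ * (xᵀ * Jmat ℚ_[p] g * x) * matQp p g B
      = xᵀ * ((matQp p g A)ᵀ * Jmat ℚ_[p] g * matQp p g A) * x := by
    calc _ = (x * matQp p g B)ᵀ * Jmat ℚ_[p] g * (x * matQp p g B) := by
          simp only [Matrix.transpose_mul, mul_assoc]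
      _ = _ := by rw [← h]; simp only [Matrix.transpose_mul, mul_assoc]
  rw [mul_smul_comm, smul_mul_assoc, this, hA, mul_smul_comm, smul_mul_assoc, hx, smul_comm η μ,
    smul_smul, inv_mul_cancel₀ hμ, one_smul]

theorem exists_multiplier {A : Matrix (Fin g ⊕ Fin g) (Fin g ⊕ Fin g) ℤ_[p]}
    (hA : A ∈ GSpZp p g) : ∃ η : ℚ_[p], η ≠ 0 ∧
      (matQp p g A)ᵀ * Jmat ℚ_[p] g * matQp p g A = η • Jmat ℚ_[p] g := by
  obtain ⟨η, h⟩ := hA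
  have hJ : (Jmat ℤ_[p] g).map PadicInt.Coe.ringHom = Jmat ℚ_[p] g := by
    simp [Jmat, Matrix.fromBlocks_map, Matrix.map_neg]
  refine ⟨(η : ℤ_[p]), by simp, ?_⟩
  have h' := congrArg (fun M => M.map (PadicInt.Coe.ringHom (p := p))) h
  simp only [Matrix.map_mul, hJ] at h'
  refine h'.trans ?_
  rw [← hJ]
  ext i j
  exact map_mul PadicInt.Coe.ringHom _ _

theorem continuous_matQp : Continuous (matQp p g) :=
  Continuous.matrix_map continuous_id continuous_subtype_val

attribute [local instance] Matrix.linftyOpNormedRing Matrix.linftyOpNormedAlgebra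

/-- The conjugacy class of a regular semisimple similitude is relatively open among the similitudes
with given multiplier and annihilating polynomial. -/
theorem eventually_conjQp {η : ℚ_[p]} (hη : η ≠ 0) {f : ℚ_[p][X]} (hf : f.Separable)
    {d : Matrix (Fin g ⊕ Fin g) (Fin g ⊕ Fin g) ℤ_[p]} (hd : aeval (matQp p g d) f = 0)
    (hdη : (matQp p g d)ᵀ * Jmat ℚ_[p] g * matQp p g d = η • Jmat ℚ_[p] g) :
    ∀ᶠ a in 𝓝 d, (matQp p g a)ᵀ * Jmat ℚ_[p] g * matQp p g a = η • Jmat ℚ_[p] g →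
      aeval (matQp p g a) f = 0 → ConjQp p g d a := by
  have : @CompleteSpace (Matrix (Fin g ⊕ Fin g) (Fin g ⊕ Fin g) ℚ_[p])
      PseudoMetricSpace.toUniformSpace :=
    FiniteDimensional.complete ℚ_[p] _
  have hσ : Continuous (symplecticAdjoint (g := g) (R := ℚ_[p])) := by
    unfold symplecticAdjoint
    fun_prop
  have key := eventually_exists_unitary_conj (K := ℚ_[p]) two_ne_zero symplecticAdjoint hσ
    symplecticAdjoint_mul symplecticAdjoint_symplecticAdjoint hη hf hd
    (symplecticAdjoint_mul_self_iff.mpr hdη)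
  filter_upwards [(continuous_matQp.tendsto d).eventually key] with a ha h1 h2
  have h3 := symplecticAdjoint_mul_self_iff.mpr h1
  obtain ⟨h, w, hw, hh, hc⟩ := ha (mul_symplecticAdjoint_self hη h3) h2
  refine conjQp_iff.mpr ⟨h, ⟨?_, 1, one_ne_zero, ?_⟩, hc⟩
  · rw [← Matrix.isUnit_iff_isUnit_det]
    exact IsUnit.of_mul_eq_one _ hw
  · exact symplecticAdjoint_mul_self_iff.mp (by rw [hh, map_one])

theorem isClosed_annihilated_similitudes (η : ℚ_[p]) (f : ℚ_[p][X]) :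
    IsClosed {a : Matrix (Fin g ⊕ Fin g) (Fin g ⊕ Fin g) ℤ_[p] |
      (matQp p g a)ᵀ * Jmat ℚ_[p] g * matQp p g a = η • Jmat ℚ_[p] g ∧
        aeval (matQp p g a) f = 0} := by
  have hc := continuous_matQp (p := p) (g := g)
  exact (isClosed_eq (by fun_prop) continuous_const).inter
    (isClosed_eq (f.continuous_aeval.comp hc) continuous_const)

theorem norm_sub_le_of_πmod_eq {n : ℕ} {A B : Matrix (Fin g ⊕ Fin g) (Fin g ⊕ Fin g) ℤ_[p]}
    (h : πmod p g n A = πmod p g n B) (i j : Fin g ⊕ Fin g) :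
    ‖A i j - B i j‖ ≤ (p : ℝ) ^ (-n : ℤ) := by
  rw [PadicInt.norm_le_pow_iff_mem_span_pow, ← PadicInt.ker_toZModPow, RingHom.mem_ker, map_sub,
    sub_eq_zero]
  exact congrFun (congrFun h i) j

end Conjugacy

/-- Lemma 4.4(b), `lem:U_n(b)`, of the paper: distinct
rational conjugacy classes inside a stable class of regular semisimple
integral elements have disjoint `p`-adic neighbourhoods. -/
theorem statement7 (p : ℕ) [Fact p.Prime] (g : ℕ) (hg : 1 ≤ g)
    (γ' γ'' : Matrix (Fin g ⊕ Fin g) (Fin g ⊕ Fin g) ℤ_[p])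
    (h1 : γ' ∈ GSpZp p g) (h2 : γ'' ∈ GSpZp p g)
    (hss1 : RegSS p g γ') (hss2 : RegSS p g γ'')
    (hchar : γ'.charpoly = γ''.charpoly)
    (hnc : ¬ ConjQp p g γ' γ'') :
    ∃ N : ℕ, ∀ n : ℕ, N ≤ n →
      ¬ ∃ δ' δ'' : Matrix (Fin g ⊕ Fin g) (Fin g ⊕ Fin g) ℤ_[p],
          δ' ∈ GSpZp p g ∧ δ'' ∈ GSpZp p g ∧
          ConjQp p g γ' δ' ∧ ConjQp p g γ'' δ'' ∧
          πmod p g n δ' = πmod p g n δ'' := by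
  by_contra! H
  choose n hn a b _ _ ha hb hab using H
  have : CompactSpace (Matrix (Fin g ⊕ Fin g) (Fin g ⊕ Fin g) ℤ_[p]) :=
    inferInstanceAs (CompactSpace (Fin g ⊕ Fin g → Fin g ⊕ Fin g → ℤ_[p]))
  have : FirstCountableTopology (Matrix (Fin g ⊕ Fin g) (Fin g ⊕ Fin g) ℤ_[p]) :=
    inferInstanceAs (FirstCountableTopology (Fin g ⊕ Fin g → Fin g ⊕ Fin g → ℤ_[p]))
  obtain ⟨d, φ, hφ, hd⟩ := CompactSpace.tendsto_subseq a
  have hp : (1 : ℝ) < p := by exact_mod_cast (Fact.out : p.Prime).one_lt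
  have hd' : Tendsto (b ∘ φ) atTop (𝓝 d) := by
    refine tendsto_pi_nhds.mpr fun i => tendsto_pi_nhds.mpr fun j => ?_
    have hz : Tendsto (fun k => a (φ k) i j - b (φ k) i j) atTop (𝓝 0) := by
      refine squeeze_zero_norm (a := fun k => ((p : ℝ)⁻¹) ^ (n (φ k)))
        (fun k => (norm_sub_le_of_πmod_eq (hab _) i j).trans_eq (by simp)) ?_
      exact (tendsto_pow_atTop_nhds_zero_of_lt_one (by positivity) (inv_lt_one_of_one_lt₀ hp)).comp
        ((tendsto_atTop_mono hn tendsto_id).comp hφ.tendsto_atTop)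
    have hij := tendsto_pi_nhds.mp (tendsto_pi_nhds.mp hd i) j
    simpa using hij.sub hz
  set f := (matQp p g γ').charpoly with hf
  have hf' : (matQp p g γ'').charpoly = f := by
    have h := congrArg (Polynomial.map (PadicInt.Coe.ringHom (p := p))) hchar
    rw [← Matrix.charpoly_map, ← Matrix.charpoly_map] at h
    exact h.symm
  obtain ⟨η, hη, e1⟩ := exists_multiplier h1
  obtain ⟨θ, hθ, e2⟩ := exists_multiplier h2
  have ha' (k : ℕ) := And.intro ((ha k).multiplier e1)
    (show aeval (matQp p g (a k)) f = 0 by rw [hf, ← (ha k).charpoly_eq, Matrix.aeval_self_charpoly])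
  have hb' (k : ℕ) := And.intro ((hb k).multiplier e2)
    (show aeval (matQp p g (b k)) f = 0 by rw [← hf', ← (hb k).charpoly_eq, Matrix.aeval_self_charpoly])
  have da := (isClosed_annihilated_similitudes η f).mem_of_tendsto hd (.of_forall fun k => ha' _)
  have db := (isClosed_annihilated_similitudes θ f).mem_of_tendsto hd' (.of_forall fun k => hb' _)
  obtain ⟨k, hk, hk'⟩ := ((hd.eventually (eventually_conjQp hη hss1 da.2 da.1)).and
    (hd'.eventually (eventually_conjQp hθ hss1 db.2 db.1))).exists
  exact hnc ((ha _).trans ((hk (ha' _).1 (ha' _).2).symm.trans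
    ((hk' (hb' _).1 (hb' _).2).trans (hb _).symm)))
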